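/- arXiv:2103.04269 — 3 statements merged into one kernel-verified Lean document; each statement's English description precedes it below -/
import Mathlib

section
/- Let X be a finite topological space and A ⊆ X. Then A is locally closed if and only if for all x, y, z ∈ X the conditions x, z ∈ A, x ∈ cl{y}, and y ∈ cl{z} imply y ∈ A. -/
/-- In a finite topological space `X`, a subset `A` is locally closed (every `x ∈ A`
has a neighborhood `U` such that `A ∩ U` is closed in the subspace `U`) if and only if
for all `x, y, z ∈ X` with `x, z ∈ A`, `x ∈ cl {y}`, and `y ∈ cl {z}` one has `y ∈ A`. -/
theorem stmt_3 {X : Type*} [TopologicalSpace X] [Finite X] (A : Set X) :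
    (∀ x ∈ A, ∃ U ∈ nhds x, IsClosed {y : U | (y : X) ∈ A}) ↔
      (∀ x y z : X, x ∈ A → z ∈ A → x ∈ closure {y} → y ∈ closure {z} → y ∈ A) := by
  simp only [← specializes_iff_mem_closure]
  constructor
  · intro h x y z hx hz hyx hzy
    obtain ⟨U, hU, hA⟩ := h x hx
    have hyU : y ∈ U := mem_of_mem_nhds (hyx hU)
    have hzU : z ∈ U := mem_of_mem_nhds ((hzy.trans hyx) hU)
    have hs : (⟨z, hzU⟩ : U) ⤳ ⟨y, hyU⟩ := (subtype_specializes_iff _ _).2 hzy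
    exact hs.mem_closed hA hz
  · intro h x hx
    refine ⟨nhdsKer {x}, isOpen_nhdsKer.mem_nhds (subset_nhdsKer rfl), ?_⟩
    rw [← isOpen_compl_iff, isOpen_iff_forall_specializes]
    intro z y hzy hy hz
    exact hy (h x y z hx hz (mem_nhdsKer_singleton.1 y.2) ((subtype_specializes_iff _ _).1 hzy))
end

section
/- Let (P,C,d) be a poset filtered chain complex over a ring R and let J ⊆ P be a convex subset. Then: (i) the pair (C_J, d_{JJ}) with d_{JJ} := π_J ∘ d ∘ ι_J is a chain complex, i.e., (d_{JJ})² = 0; (ii) (C_J, d_{JJ}) is chain isomorphic to the quotient chain complex (C_{J^≤}/C_{J^<}, d'), where d' is the boundary operator induced by d_{J^≤ J^≤} (this quotient is well defined since J^< is a down set), via the chain map C_J ∋ x ↦ [x] ∈ C_{J^≤}/C_{J^<}. -/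
section

variable {R : Type*} [Ring R] {P : Type*} [PartialOrder P] [DecidableEq P]
  {M : Type*} [AddCommGroup M] [Module R M]

/-- The down closure `J^≤` of a subset `J` of a poset. -/
def downCl (J : Set P) : Set P := {x : P | ∃ a ∈ J, x ≤ a}

/-- The submodule `C_J = ⊕_{p ∈ J} C_p` of a `P`-graded module. -/
noncomputable def modPart (𝓒 : P → Submodule R M) (J : Set P) : Submodule R M :=
  ⨆ p ∈ J, 𝓒 p

open Classical in
/-- The canonical projection `π_J` of a `P`-graded module onto `C_J = ⊕_{p∈J} C_p`
(viewed as an endomorphism of `M`, i.e. `ι_J ∘ π_J`). -/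
noncomputable def projOn (𝓒 : P → Submodule R M) [DirectSum.Decomposition 𝓒] (J : Set P) :
    M →ₗ[R] M :=
  (DirectSum.toModule R P M fun p => if p ∈ J then (𝓒 p).subtype else 0).comp
    (DirectSum.decomposeLinearEquiv 𝓒).toLinearMap

omit [PartialOrder P] in
theorem mem_modPart_iff (𝓒 : P → Submodule R M) [DirectSum.Decomposition 𝓒] (J : Set P) (x : M) :
    x ∈ modPart 𝓒 J ↔ ∀ p ∉ J, (DirectSum.decompose 𝓒 x p : M) = 0 := by
  classical
  constructor
  · intro hx p hp
    have hle : modPart 𝓒 J ≤ LinearMap.ker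
        (DirectSum.component R P (fun i => 𝓒 i) p ∘ₗ
          (DirectSum.decomposeLinearEquiv 𝓒).toLinearMap) := by
      refine iSup₂_le fun q hq y hy => ?_
      have hqp : q ≠ p := fun h => hp (h ▸ hq)
      exact Subtype.ext (DirectSum.decompose_of_mem_ne 𝓒 hy hqp)
    exact congrArg Subtype.val (LinearMap.mem_ker.mp (hle hx))
  · intro h
    rw [← DirectSum.sum_support_decompose 𝓒 x]
    refine Submodule.sum_mem _ fun p _ => ?_
    by_cases hp : p ∈ J
    · exact (le_iSup₂_of_le p hp le_rfl : 𝓒 p ≤ modPart 𝓒 J) (SetLike.coe_mem _)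
    · rw [h p hp]
      exact Submodule.zero_mem _

omit [PartialOrder P] in
open Classical in
theorem decompose_projOn (𝓒 : P → Submodule R M) [DirectSum.Decomposition 𝓒] (J : Set P)
    (x : M) (p : P) :
    (DirectSum.decompose 𝓒 (projOn 𝓒 J x) p : M) =
      if p ∈ J then (DirectSum.decompose 𝓒 x p : M) else 0 := by
  induction x using DirectSum.Decomposition.inductionOn 𝓒 with
  | zero => simp
  | @homogeneous q m =>
    have hm : projOn 𝓒 J (m : M) = if q ∈ J then (m : M) else 0 := by
      simp only [projOn, LinearMap.comp_apply, LinearEquiv.coe_coe,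
        DirectSum.decomposeLinearEquiv_apply, DirectSum.decompose_coe]
      rw [← DirectSum.lof_eq_of R, DirectSum.toModule_lof]
      split_ifs <;> simp
    rw [hm]
    by_cases hqp : q = p
    · subst hqp
      split_ifs <;> simp
    · have h0 := DirectSum.decompose_of_mem_ne 𝓒 m.2 hqp
      split_ifs <;> simp only [h0, DirectSum.decompose_zero, DirectSum.zero_apply,
        ZeroMemClass.coe_zero]
  | add a b ha hb =>
    simp only [map_add, DirectSum.decompose_add, DirectSum.add_apply, Submodule.coe_add, ha, hb]
    split_ifs <;> simp

omit [PartialOrder P] in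
theorem projOn_mem_modPart (𝓒 : P → Submodule R M) [DirectSum.Decomposition 𝓒] (J : Set P)
    (x : M) : projOn 𝓒 J x ∈ modPart 𝓒 J := by
  rw [mem_modPart_iff]
  intro p hp
  rw [decompose_projOn, if_neg hp]

omit [PartialOrder P] in
theorem projOn_eq_zero_of_mem_modPart (𝓒 : P → Submodule R M) [DirectSum.Decomposition 𝓒]
    {J K : Set P} (hJK : Disjoint J K) {x : M} (hx : x ∈ modPart 𝓒 K) : projOn 𝓒 J x = 0 := by
  apply (DirectSum.decompose 𝓒).injective
  refine DFinsupp.ext fun p => Subtype.ext ?_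
  rw [decompose_projOn, DirectSum.decompose_zero]
  split_ifs with hp
  · exact (mem_modPart_iff 𝓒 K x).mp hx p (Set.disjoint_left.mp hJK hp)
  · rfl

omit [PartialOrder P] in
theorem projOn_sub_self_mem_modPart (𝓒 : P → Submodule R M) [DirectSum.Decomposition 𝓒]
    (J : Set P) {K : Set P} {x : M} (hx : x ∈ modPart 𝓒 K) :
    projOn 𝓒 J x - x ∈ modPart 𝓒 (K \ J) := by
  rw [mem_modPart_iff] at hx ⊢
  intro p hp
  rw [DirectSum.decompose_sub, DirectSum.sub_apply, Submodule.coe_sub, decompose_projOn]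
  split_ifs with hpJ
  · exact sub_self _
  · rw [hx p fun hpK => hp ⟨hpK, hpJ⟩, sub_zero]

omit [PartialOrder P] [DecidableEq P] in
theorem modPart_mono (𝓒 : P → Submodule R M) {J K : Set P} (h : J ⊆ K) :
    modPart 𝓒 J ≤ modPart 𝓒 K :=
  biSup_mono h

theorem map_mem_modPart_of_isLowerSet (𝓒 : P → Submodule R M) [DirectSum.Decomposition 𝓒]
    (d : M →ₗ[R] M)
    (hfilt : ∀ p q : P, (∃ x ∈ 𝓒 q, (DirectSum.decompose 𝓒 (d x) p : M) ≠ 0) → p ≤ q)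
    {K : Set P} (hK : IsLowerSet K) {x : M} (hx : x ∈ modPart 𝓒 K) : d x ∈ modPart 𝓒 K := by
  have hle : modPart 𝓒 K ≤ (modPart 𝓒 K).comap d := by
    refine iSup₂_le fun q hq y hy => ?_
    rw [Submodule.mem_comap, mem_modPart_iff]
    intro p hp
    by_contra hne
    exact hp (hK (hfilt p q ⟨y, hy, hne⟩) hq)
  exact hle hx

omit [DecidableEq P] in
theorem subset_downCl (J : Set P) : J ⊆ downCl J := fun a ha => ⟨a, ha, le_rfl⟩

omit [DecidableEq P] in
theorem isLowerSet_downCl (J : Set P) : IsLowerSet (downCl J) :=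
  fun _ _ hba ⟨c, hc, hac⟩ => ⟨c, hc, hba.trans hac⟩

omit [DecidableEq P] in
theorem isLowerSet_downCl_diff {J : Set P}
    (hJ : ∀ ⦃x y z : P⦄, x ∈ J → z ∈ J → x ≤ y → y ≤ z → y ∈ J) :
    IsLowerSet (downCl J \ J) := by
  rintro a b hba ⟨⟨c, hc, hac⟩, haJ⟩
  exact ⟨⟨c, hc, hba.trans hac⟩, fun hb => haJ (hJ hb hc hba hac)⟩

/-- Let `(P,C,d)` be a poset filtered chain complex over a ring `R` and `J ⊆ P` convex.
Then (i) `(C_J, d_{JJ})` with `d_{JJ} = π_J ∘ d ∘ ι_J` is a chain complex, i.e.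
`(d_{JJ})² = 0`; and (ii) `(C_J, d_{JJ})` is chain isomorphic to the quotient complex
`(C_{J^≤}/C_{J^<}, d')` induced by `d`, via the chain map `C_J ∋ x ↦ [x]`:  this map is
injective, its range is the image of `C_{J^≤}` in the quotient `M/C_{J^<}` (which is
canonically `C_{J^≤}/C_{J^<}`), and it intertwines `d_{JJ}` with the induced boundary,
i.e. `[d_{JJ} x] = [d x]` for `x ∈ C_J`. -/
theorem stmt_6 [Fintype P]
    (𝓒 : P → Submodule R M) [DirectSum.Decomposition 𝓒]
    (𝓩 : ℤ → Submodule R M) [DirectSum.Decomposition 𝓩]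
    (hgr : ∀ p : P, ∀ x ∈ 𝓒 p, ∀ n : ℤ, (DirectSum.decompose 𝓩 x n : M) ∈ 𝓒 p)
    (d : M →ₗ[R] M)
    (hdeg : ∀ n : ℤ, ∀ x ∈ 𝓩 n, d x ∈ 𝓩 (n - 1))
    (hd2 : d ∘ₗ d = 0)
    (hfilt : ∀ p q : P, (∃ x ∈ 𝓒 q, (DirectSum.decompose 𝓒 (d x) p : M) ≠ 0) → p ≤ q)
    (J : Set P) (hJ : ∀ ⦃x y z : P⦄, x ∈ J → z ∈ J → x ≤ y → y ≤ z → y ∈ J) :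
    ((projOn 𝓒 J ∘ₗ d ∘ₗ projOn 𝓒 J) ∘ₗ (projOn 𝓒 J ∘ₗ d ∘ₗ projOn 𝓒 J) = 0) ∧
    Function.Injective
      ((modPart 𝓒 (downCl J \ J)).mkQ ∘ₗ (modPart 𝓒 J).subtype) ∧
    LinearMap.range ((modPart 𝓒 (downCl J \ J)).mkQ ∘ₗ (modPart 𝓒 J).subtype) =
      Submodule.map (modPart 𝓒 (downCl J \ J)).mkQ (modPart 𝓒 (downCl J)) ∧
    (∀ x ∈ modPart 𝓒 J,
      (modPart 𝓒 (downCl J \ J)).mkQ (projOn 𝓒 J (d x)) =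
        (modPart 𝓒 (downCl J \ J)).mkQ (d x)) := by
  have hd : ∀ x ∈ modPart 𝓒 J, projOn 𝓒 J (d x) - d x ∈ modPart 𝓒 (downCl J \ J) :=
    fun x hx => projOn_sub_self_mem_modPart 𝓒 J (map_mem_modPart_of_isLowerSet 𝓒 d hfilt
      (isLowerSet_downCl J) (modPart_mono 𝓒 (subset_downCl J) hx))
  refine ⟨?_, ?_, ?_, ?_⟩
  · ext x
    simp only [LinearMap.comp_apply, LinearMap.zero_apply]
    have hidem : ∀ y, projOn 𝓒 J (projOn 𝓒 J y) = projOn 𝓒 J y := fun y => by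
      have h := projOn_sub_self_mem_modPart 𝓒 J (projOn_mem_modPart 𝓒 J y)
      rw [Set.sdiff_self] at h
      simpa [modPart, sub_eq_zero] using h
    rw [hidem]
    have h := map_mem_modPart_of_isLowerSet 𝓒 d hfilt (isLowerSet_downCl_diff hJ)
      (hd _ (projOn_mem_modPart 𝓒 J x))
    have hdd : d (d (projOn 𝓒 J x)) = 0 := LinearMap.congr_fun hd2 _
    rw [map_sub, hdd, sub_zero] at h
    exact projOn_eq_zero_of_mem_modPart 𝓒 Set.disjoint_sdiff_right h
  · rw [← LinearMap.ker_eq_bot, LinearMap.ker_eq_bot']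
    rintro ⟨x, hx⟩ h
    have hx' : x ∈ modPart 𝓒 (downCl J \ J) := (Submodule.Quotient.mk_eq_zero _).mp h
    have hz := projOn_eq_zero_of_mem_modPart 𝓒 Set.disjoint_sdiff_right hx'
    have h0 := projOn_sub_self_mem_modPart 𝓒 J hx
    rw [Set.sdiff_self, hz] at h0
    exact Subtype.ext (by simpa [modPart] using h0)
  · rw [LinearMap.range_comp, Submodule.range_subtype]
    refine le_antisymm (Submodule.map_mono (modPart_mono 𝓒 (subset_downCl J))) ?_
    rintro _ ⟨y, hy, rfl⟩
    exact ⟨projOn 𝓒 J y, projOn_mem_modPart 𝓒 J y,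
      (Submodule.Quotient.eq _).mpr (projOn_sub_self_mem_modPart 𝓒 J hy)⟩
  · exact fun x hx => (Submodule.Quotient.eq _).mpr (hd x hx)

end
end

section
/- Let P be a finite nonempty poset and let (P,C,d) be a poset filtered chain complex over a field R. Then there exist families (W_p)_{p∈P}, (V_p)_{p∈P}, (B_p)_{p∈P}, (H_p)_{p∈P} of ℤ-graded submodules of C such that: (i) C = ⊕_{p∈P} W_p and the P-gradation (W_p) is filtered equivalent to (C_p), i.e., ⊕_{p∈L} W_p = ⊕_{p∈L} C_p for every down set L of P; (ii) W_p = V_p ⊕ H_p ⊕ B_p for every p ∈ P; (iii) d(V_p) ⊆ B_p and the restriction of d to V_p is a module isomorphism onto B_p; (iv) π_p(d(h)) = 0 for every h ∈ H_p and p ∈ P (where π_p is the projection onto W_p determined by the decomposition in (i)); (v) for H := ⊕_{p∈P} H_p one has d(H) ⊆ H, and moreover d(⊕_{p∈L} H_p) ⊆ ⊕_{p∈L} H_p for every down set L of P, so that (P,H,d|_H) is again a poset filtered chain complex. -/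
section RingIdentities

variable {A : Type*} [Ring A]

/-- A generalized inverse of a square-zero element can be chosen reflexive and square-zero. -/
theorem normalized_generalized_inverse {D g : A} (hD : D * D = 0) (hg : D * g * D = D) :
    ∃ t, t = g * D * g - g * D * g * (g * D * g) * D ∧
      D * t * D = D ∧ t * D * t = t ∧ t * t = 0 := by
  have hg' : D * (g * D) = D := by rw [← mul_assoc, hg]
  have hgx (x : A) : D * (g * (D * x)) = D * x := by rw [← mul_assoc, ← mul_assoc, hg]
  refine ⟨_, rfl, ?_, ?_, ?_⟩ <;>
    simp [mul_sub, sub_mul, mul_assoc, hD, hg', hgx]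

theorem exists_inverse_one_add_of_isNilpotent {N : A} (hN : IsNilpotent N) (S : Subring A)
    (hS : N ∈ S) : ∃ M ∈ S, M * (1 + N) = 1 ∧ (1 + N) * M = 1 := by
  have h : IsNilpotent (⟨N, hS⟩ : S) := by
    obtain ⟨k, hk⟩ := hN
    exact ⟨k, Subtype.ext (by simpa using hk)⟩
  obtain ⟨u, hu⟩ := h.isUnit_one_add
  have hu' : (u : S).1 = 1 + N := by rw [hu]; rfl
  refine ⟨(↑u⁻¹ : S), (↑u⁻¹ : S).2, ?_, ?_⟩
  · rw [← hu']; exact congrArg Subtype.val u.inv_mul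
  · rw [← hu']; exact congrArg Subtype.val u.mul_inv

/-- The perturbed homotopy `t * (1 + (d - D) * t)⁻¹` of the basic perturbation lemma. -/
theorem perturbed_homotopy {d D t M : A} (htD : t * D * t = t)
    (htt : t * t = 0) (hM : M * (1 + (d - D) * t) = 1) :
    t * M * t = 0 ∧ t * M * d * t = t ∧ t * M * (1 - t * D - D * t) = 0 := by
  have h1 : M * t = t := by
    calc M * t = M * (1 + (d - D) * t) * t - M * (d - D) * (t * t) := by noncomm_ring
      _ = t := by rw [hM, htt]; simp
  have h2 : M * (d * t) = D * t := by
    calc M * (d * t) = M * (1 + (d - D) * t) * (D * t) + M * (d - D) * (t - t * D * t) := by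
          noncomm_ring
      _ = D * t := by rw [hM, htD]; simp
  have h3 : t * (1 - t * D - D * t) = 0 := by
    calc t * (1 - t * D - D * t) = t - (t * t) * D - t * D * t := by noncomm_ring
      _ = 0 := by rw [htt, htD]; simp
  have h4 : M * (1 - t * D - D * t) = 1 - t * D - D * t := by
    calc M * (1 - t * D - D * t) = M * (1 + (d - D) * t) * (1 - t * D - D * t)
            - M * (d - D) * (t * (1 - t * D - D * t)) := by noncomm_ring
      _ = _ := by rw [hM, h3]; simp
  refine ⟨by rw [mul_assoc, h1, htt], ?_, by rw [mul_assoc, h4, h3]⟩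
  rw [mul_assoc, mul_assoc, h2, ← mul_assoc, htD]

end RingIdentities

section Projections

variable {R : Type*} [Ring R] {C : Type*} [AddCommGroup C] [Module R C]
  {ι : Type*} [DecidableEq ι] (𝓜 : ι → Submodule R C) [DirectSum.Decomposition 𝓜]

/-- The projection onto the `i`-th summand, as an endomorphism. -/
def componentEnd (i : ι) : Module.End R C :=
  (𝓜 i).subtype ∘ₗ DirectSum.component R ι (fun i => 𝓜 i) i ∘ₗ
    (DirectSum.decomposeLinearEquiv 𝓜).toLinearMap

theorem componentEnd_apply (i : ι) (x : C) :
    componentEnd 𝓜 i x = (DirectSum.decompose 𝓜 x i : C) := rfl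

theorem componentEnd_mem (i : ι) (x : C) : componentEnd 𝓜 i x ∈ 𝓜 i :=
  (DirectSum.decompose 𝓜 x i).2

theorem componentEnd_of_mem {i : ι} {x : C} (hx : x ∈ 𝓜 i) : componentEnd 𝓜 i x = x :=
  DirectSum.decompose_of_mem_same 𝓜 hx

theorem componentEnd_of_mem_ne {i j : ι} {x : C} (hx : x ∈ 𝓜 i) (hij : i ≠ j) :
    componentEnd 𝓜 j x = 0 :=
  DirectSum.decompose_of_mem_ne 𝓜 hx hij

theorem sum_componentEnd [Fintype ι] (x : C) : ∑ i, componentEnd 𝓜 i x = x := by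
  classical
  conv_rhs => rw [← DirectSum.sum_support_decompose 𝓜 x]
  symm
  apply Finset.sum_subset (Finset.subset_univ _)
  intro i _ hi
  simpa [componentEnd_apply] using hi

theorem linearMap_eq_of_eqOn_summands {E : Type*} [AddCommGroup E] [Module R E]
    {f g : C →ₗ[R] E} (h : ∀ i, ∀ x ∈ 𝓜 i, f x = g x) : f = g := by
  ext x
  induction x using DirectSum.Decomposition.inductionOn 𝓜 with
  | zero => simp
  | homogeneous x => exact h _ _ x.2
  | add x y hx hy => simp [hx, hy]

/-- The endomorphisms preserving the span of the summands indexed by every down set. -/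
def filteredSubring {P : Type*} [PartialOrder P] (𝓒 : P → Submodule R C) :
    Subring (Module.End R C) where
  carrier := {f | ∀ L : Set P, IsLowerSet L → ∀ x ∈ (⨆ p ∈ L, 𝓒 p : Submodule R C),
    f x ∈ (⨆ p ∈ L, 𝓒 p : Submodule R C)}
  mul_mem' hf hg L hL x hx := hf L hL _ (hg L hL x hx)
  one_mem' _ _ _ hx := hx
  add_mem' hf hg L hL x hx := add_mem (hf L hL x hx) (hg L hL x hx)
  zero_mem' _ _ _ _ := zero_mem _
  neg_mem' hf L hL x hx := neg_mem (hf L hL x hx)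

theorem mem_filteredSubring {P : Type*} [PartialOrder P] {𝓒 : P → Submodule R C}
    {f : Module.End R C}
    (h : ∀ p, ∀ x ∈ 𝓒 p, f x ∈ (⨆ q ∈ Set.Iic p, 𝓒 q : Submodule R C)) :
    f ∈ filteredSubring 𝓒 := by
  intro L hL
  change (⨆ p ∈ L, 𝓒 p) ≤ (⨆ p ∈ L, 𝓒 p).comap f
  refine iSup₂_le fun p hp x hx => ?_
  exact (biSup_mono fun q (hq : q ≤ p) => hL hq hp : _ ≤ ⨆ q ∈ L, 𝓒 q) (h p x hx)

theorem mem_filteredSubring_of_preserves {P : Type*} [PartialOrder P] {𝓒 : P → Submodule R C}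
    {f : Module.End R C} (h : ∀ p, ∀ x ∈ 𝓒 p, f x ∈ 𝓒 p) : f ∈ filteredSubring 𝓒 :=
  mem_filteredSubring fun p x hx => le_biSup 𝓒 (Set.mem_Iic.2 le_rfl) (h p x hx)

/-- An endomorphism that strictly lowers a finite poset filtration is nilpotent. -/
theorem isNilpotent_of_strictly_filtered {P : Type*} [PartialOrder P] [Finite P]
    {𝓒 : P → Submodule R C} (htop : ⨆ p, 𝓒 p = ⊤) {N : Module.End R C}
    (h : ∀ p, ∀ x ∈ 𝓒 p, N x ∈ (⨆ q ∈ Set.Iio p, 𝓒 q : Submodule R C)) : IsNilpotent N := by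
  have ker_pow_mono {k m : ℕ} (hkm : k ≤ m) : LinearMap.ker (N ^ k) ≤ LinearMap.ker (N ^ m) := by
    rw [← Nat.sub_add_cancel hkm, pow_add]
    exact LinearMap.ker_le_ker_comp _ _
  have key : ∀ p, ∃ k, 𝓒 p ≤ LinearMap.ker (N ^ k) := by
    intro p
    induction p using WellFoundedLT.induction with
    | _ p ih =>
      choose! k hk using ih
      obtain ⟨m, hm⟩ := (Set.finite_range k).bddAbove
      refine ⟨m + 1, fun x hx => ?_⟩
      rw [LinearMap.mem_ker, pow_succ, Module.End.mul_apply, ← LinearMap.mem_ker]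
      refine (iSup₂_le fun q hq => ?_ :
        (⨆ q ∈ Set.Iio p, 𝓒 q : Submodule R C) ≤ _) (h p x hx)
      exact (hk q hq).trans (ker_pow_mono (hm ⟨q, rfl⟩))
  choose k hk using key
  obtain ⟨m, hm⟩ := (Set.finite_range k).bddAbove
  refine ⟨m, LinearMap.ker_eq_top.1 (top_le_iff.1 ?_)⟩
  rw [← htop]
  exact iSup_le fun p => (hk p).trans (ker_pow_mono (hm ⟨p, rfl⟩))

/-- `f` shifts the ℤ-grading `𝓩` by `k`. -/
def ShiftsDegree (𝓩 : ℤ → Submodule R C) [DirectSum.Decomposition 𝓩] (k : ℤ)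
    (f : Module.End R C) : Prop :=
  ∀ n, f * componentEnd 𝓩 n = componentEnd 𝓩 (n + k) * f

namespace ShiftsDegree

variable {𝓩 : ℤ → Submodule R C} [DirectSum.Decomposition 𝓩] {k l : ℤ} {f g : Module.End R C}

theorem of_mem (h : ∀ n, ∀ x ∈ 𝓩 n, f x ∈ 𝓩 (n + k)) : ShiftsDegree 𝓩 k f := by
  intro n
  refine linearMap_eq_of_eqOn_summands 𝓩 fun m x hx => ?_
  simp only [Module.End.mul_apply]
  by_cases hmn : m = n
  · subst hmn
    rw [componentEnd_of_mem 𝓩 hx, componentEnd_of_mem 𝓩 (h _ _ hx)]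
  · rw [componentEnd_of_mem_ne 𝓩 hx hmn, componentEnd_of_mem_ne 𝓩 (h _ _ hx) (by omega), map_zero]

theorem mul (hf : ShiftsDegree 𝓩 k f) (hg : ShiftsDegree 𝓩 l g) :
    ShiftsDegree 𝓩 (k + l) (f * g) := by
  intro n
  rw [mul_assoc, hg, ← mul_assoc, hf, mul_assoc, add_assoc, add_comm l k]

theorem sub (hf : ShiftsDegree 𝓩 k f) (hg : ShiftsDegree 𝓩 k g) :
    ShiftsDegree 𝓩 k (f - g) := by
  intro n
  rw [sub_mul, mul_sub, hf, hg]

theorem add (hf : ShiftsDegree 𝓩 k f) (hg : ShiftsDegree 𝓩 k g) :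
    ShiftsDegree 𝓩 k (f + g) := by
  intro n
  rw [add_mul, mul_add, hf, hg]

theorem one : ShiftsDegree 𝓩 0 (1 : Module.End R C) := by
  intro n
  simp

theorem sum {ι : Type*} {s : Finset ι} {f : ι → Module.End R C}
    (hf : ∀ i ∈ s, ShiftsDegree 𝓩 k (f i)) : ShiftsDegree 𝓩 k (∑ i ∈ s, f i) := by
  intro n
  rw [Finset.sum_mul, Finset.mul_sum]
  exact Finset.sum_congr rfl fun i hi => hf i hi n

theorem iff_mem_centralizer :
    ShiftsDegree 𝓩 0 f ↔ f ∈ Subring.centralizer (Set.range (componentEnd 𝓩)) := by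
  simp [ShiftsDegree, Subring.mem_centralizer_iff, eq_comm]

theorem map_isGraded (hf : ShiftsDegree 𝓩 0 f) {S : Submodule R C}
    (hS : ∀ x ∈ S, ∀ n, (DirectSum.decompose 𝓩 x n : C) ∈ S) :
    ∀ x ∈ S.map f, ∀ n, (DirectSum.decompose 𝓩 x n : C) ∈ S.map f := by
  rintro _ ⟨x, hx, rfl⟩ n
  refine ⟨_, hS x hx n, ?_⟩
  simpa [componentEnd_apply] using LinearMap.congr_fun (hf n) x

end ShiftsDegree

theorem exists_degree_part (𝓩 : ℤ → Submodule R C) [DirectSum.Decomposition 𝓩] (k : ℤ)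
    (g : Module.End R C) :
    ∃ f : Module.End R C, ∀ n, ∀ x ∈ 𝓩 n, f x = componentEnd 𝓩 (n + k) (g x) := by
  refine ⟨DirectSum.toModule R ℤ C (fun n => componentEnd 𝓩 (n + k) ∘ₗ g ∘ₗ (𝓩 n).subtype) ∘ₗ
    (DirectSum.decomposeLinearEquiv 𝓩).toLinearMap, fun n x hx => ?_⟩
  lift x to 𝓩 n using hx
  simp

theorem componentEnd_commute {f : Module.End R C} (hf : ∀ i, ∀ x ∈ 𝓜 i, f x ∈ 𝓜 i) (i : ι) :
    componentEnd 𝓜 i * f = f * componentEnd 𝓜 i := by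
  refine linearMap_eq_of_eqOn_summands 𝓜 fun j x hx => ?_
  simp only [Module.End.mul_apply]
  by_cases hij : j = i
  · subst hij
    rw [componentEnd_of_mem 𝓜 hx, componentEnd_of_mem 𝓜 (hf _ _ hx)]
  · rw [componentEnd_of_mem_ne 𝓜 hx hij, componentEnd_of_mem_ne 𝓜 (hf _ _ hx) hij, map_zero]

variable [Fintype ι]

/-- The block diagonal part of an endomorphism. -/
def diagonalPart (f : Module.End R C) : Module.End R C :=
  ∑ i, componentEnd 𝓜 i * f * componentEnd 𝓜 i

theorem diagonalPart_of_mem (f : Module.End R C) {i : ι} {x : C} (hx : x ∈ 𝓜 i) :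
    diagonalPart 𝓜 f x = componentEnd 𝓜 i (f x) := by
  rw [diagonalPart, LinearMap.sum_apply, Finset.sum_eq_single i]
  · simp [componentEnd_of_mem 𝓜 hx]
  · intro j _ hj
    simp [componentEnd_of_mem_ne 𝓜 hx hj.symm]
  · simp

theorem diagonalPart_mem (f : Module.End R C) {i : ι} {x : C} (hx : x ∈ 𝓜 i) :
    diagonalPart 𝓜 f x ∈ 𝓜 i := by
  rw [diagonalPart_of_mem 𝓜 f hx]
  exact componentEnd_mem 𝓜 i _

theorem ShiftsDegree.diagonalPart {𝓩 : ℤ → Submodule R C} [DirectSum.Decomposition 𝓩]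
    (hgr : ∀ i, ∀ x ∈ 𝓜 i, ∀ n, (DirectSum.decompose 𝓩 x n : C) ∈ 𝓜 i) {k : ℤ}
    {f : Module.End R C} (hf : ShiftsDegree 𝓩 k f) :
    ShiftsDegree 𝓩 k (diagonalPart 𝓜 f) := by
  refine ShiftsDegree.sum fun i _ => ?_
  have hi : ShiftsDegree 𝓩 0 (componentEnd 𝓜 i) := by
    intro n
    rw [add_zero]
    exact componentEnd_commute 𝓜 (fun i x hx => hgr i x hx n) i
  simpa using (hi.mul hf).mul hi

end Projections

section Field

variable {R : Type*} [Field R] {C : Type*} [AddCommGroup C] [Module R C]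
  {ι : Type*} [DecidableEq ι] (𝓜 : ι → Submodule R C) [DirectSum.Decomposition 𝓜]

theorem exists_generalized_inverse (D : Module.End R C) : ∃ g : Module.End R C, D * g * D = D := by
  obtain ⟨s, hs⟩ := D.rangeRestrict.exists_rightInverse_of_surjective D.range_rangeRestrict
  obtain ⟨g, hg⟩ := s.exists_extend
  refine ⟨g, LinearMap.ext fun x => ?_⟩
  have h1 : g (D x) = s (D.rangeRestrict x) := LinearMap.congr_fun hg (D.rangeRestrict x)
  have h2 := congrArg Subtype.val (LinearMap.congr_fun hs (D.rangeRestrict x))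
  simpa [h1] using h2

/-- A block diagonal differential admits a block diagonal homotopy of degree `1` with
`D * t * D = D`. -/
theorem exists_graded_homotopy [Fintype ι] (𝓩 : ℤ → Submodule R C) [DirectSum.Decomposition 𝓩]
    (hgr : ∀ i, ∀ x ∈ 𝓜 i, ∀ n, (DirectSum.decompose 𝓩 x n : C) ∈ 𝓜 i)
    {D : Module.End R C} (hdeg : ShiftsDegree 𝓩 (-1) D) (hmem : ∀ i, ∀ x ∈ 𝓜 i, D x ∈ 𝓜 i)
    (hD : D * D = 0) :
    ∃ t : Module.End R C, ShiftsDegree 𝓩 1 t ∧ (∀ i, ∀ x ∈ 𝓜 i, t x ∈ 𝓜 i) ∧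
      D * t * D = D ∧ t * D * t = t ∧ t * t = 0 := by
  obtain ⟨g₀, hg₀⟩ := exists_generalized_inverse D
  obtain ⟨g₁, hg₁⟩ := exists_degree_part 𝓩 1 g₀
  have hdeg₁ : ShiftsDegree 𝓩 1 g₁ := ShiftsDegree.of_mem fun n x hx => by
    rw [hg₁ n x hx]
    exact componentEnd_mem 𝓩 _ _
  have hinv₁ : D * g₁ * D = D := by
    refine linearMap_eq_of_eqOn_summands 𝓩 fun n x hx => ?_
    have hDz (m : ℤ) (y : C) : D (componentEnd 𝓩 m y) = componentEnd 𝓩 (m + -1) (D y) :=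
      LinearMap.congr_fun (hdeg m) y
    have hDx : D x = componentEnd 𝓩 (n + -1) (D x) := by
      rw [← hDz, componentEnd_of_mem 𝓩 hx]
    have hDx' : D x ∈ 𝓩 (n + -1) := hDx ▸ componentEnd_mem 𝓩 _ _
    have h := LinearMap.congr_fun hg₀ x
    simp only [Module.End.mul_apply] at h ⊢
    rw [hg₁ _ _ hDx', hDz, h, neg_add_cancel_right, ← hDx]
  have hinv : D * diagonalPart 𝓜 g₁ * D = D := by
    refine linearMap_eq_of_eqOn_summands 𝓜 fun i x hx => ?_
    have h := LinearMap.congr_fun hinv₁ x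
    have hc := LinearMap.congr_fun (componentEnd_commute 𝓜 hmem i) (g₁ (D x))
    simp only [Module.End.mul_apply] at h hc ⊢
    rw [diagonalPart_of_mem 𝓜 _ (hmem i x hx), ← hc, h, componentEnd_of_mem 𝓜 (hmem i x hx)]
  obtain ⟨t, rfl, ht⟩ := normalized_generalized_inverse hD hinv
  have hg := hdeg₁.diagonalPart 𝓜 hgr
  have hgm (i : ι) (x : C) (hx : x ∈ 𝓜 i) := diagonalPart_mem 𝓜 g₁ hx
  refine ⟨_, ?_, fun i x hx => ?_, ht⟩
  · have h := (hg.mul hdeg).mul hg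
    simpa using h.sub (((h.mul h).mul hdeg))
  · exact sub_mem (hgm i _ (hmem i _ (hgm i x hx))) (hgm i _ (hmem i _ (hgm i _ (hgm i _
      (hmem i _ (hgm i _ (hmem i x hx)))))))

end Field

section Splitting

variable {R : Type*} [Ring R] {C : Type*} [AddCommGroup C] [Module R C]

/-- Three orthogonal idempotents with sum `1` split every submodule they preserve, also after
transport along an injective endomorphism. -/
theorem map_idempotents_split {φ a b c : Module.End R C} (hφ : Function.Injective φ)
    (habc : a + c + b = 1) (haa : a * a = a) (hcc : c * c = c) (hab : a * b = 0) (hac : a * c = 0)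
    (hcb : c * b = 0) {S : Submodule R C} (ha : ∀ x ∈ S, a x ∈ S) (hb : ∀ x ∈ S, b x ∈ S)
    (hc : ∀ x ∈ S, c x ∈ S) :
    S.map (φ * a) ⊔ S.map (φ * c) ⊔ S.map (φ * b) = S.map φ ∧
      S.map (φ * a) ⊓ (S.map (φ * c) ⊔ S.map (φ * b)) = ⊥ ∧
      S.map (φ * c) ⊓ S.map (φ * b) = ⊥ := by
  refine ⟨le_antisymm ?_ ?_, ?_, ?_⟩
  · refine sup_le (sup_le ?_ ?_) ?_ <;> rintro _ ⟨x, hx, rfl⟩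
    exacts [⟨_, ha x hx, rfl⟩, ⟨_, hc x hx, rfl⟩, ⟨_, hb x hx, rfl⟩]
  · rintro _ ⟨x, hx, rfl⟩
    have h : φ x = (φ * a) x + (φ * c) x + (φ * b) x := by
      rw [← LinearMap.add_apply, ← LinearMap.add_apply, ← mul_add, ← mul_add, habc, mul_one]
    rw [h]
    exact add_mem (Submodule.mem_sup_left (add_mem
      (Submodule.mem_sup_left ⟨x, hx, rfl⟩) (Submodule.mem_sup_right ⟨x, hx, rfl⟩)))
      (Submodule.mem_sup_right ⟨x, hx, rfl⟩)
  · rw [eq_bot_iff]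
    rintro _ ⟨⟨x, -, rfl⟩, h⟩
    obtain ⟨_, ⟨y, -, rfl⟩, _, ⟨z, -, rfl⟩, h⟩ := Submodule.mem_sup.1 h
    simp only [Module.End.mul_apply, ← map_add] at h
    have h' := congrArg a (hφ h)
    simp only [map_add, ← Module.End.mul_apply, haa, hab, hac] at h'
    simp [Module.End.mul_apply, ← h']
  · rw [eq_bot_iff]
    rintro _ ⟨⟨x, -, rfl⟩, ⟨y, -, h⟩⟩
    have h' := congrArg c (hφ h)
    simp only [← Module.End.mul_apply, hcc, hcb] at h'
    simp [Module.End.mul_apply, ← h']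

theorem isInternal_map_of_bijective {ι : Type*} [DecidableEq ι] {𝓜 : ι → Submodule R C}
    (h𝓜 : DirectSum.IsInternal 𝓜) {φ : Module.End R C} (hφ : Function.Bijective φ) :
    DirectSum.IsInternal fun i => (𝓜 i).map φ := by
  rw [DirectSum.isInternal_submodule_iff_iSupIndep_and_iSup_eq_top] at h𝓜 ⊢
  refine ⟨h𝓜.1.map_orderIso (Submodule.orderIsoMapComap (LinearEquiv.ofBijective φ hφ)), ?_⟩
  rw [← Submodule.map_iSup, h𝓜.2, Submodule.map_top, LinearMap.range_eq_top.2 hφ.2]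

end Splitting

section Filtered

variable {R : Type*} [Ring R] {C : Type*} [AddCommGroup C] [Module R C]

theorem map_biSup_eq_of_mem_filteredSubring {P : Type*} [PartialOrder P]
    {𝓒 : P → Submodule R C} {f g : Module.End R C}
    (hf : f ∈ filteredSubring 𝓒) (hg : g ∈ filteredSubring 𝓒) (hfg : f * g = 1)
    {L : Set P} (hL : IsLowerSet L) : (⨆ p ∈ L, (𝓒 p).map f) = ⨆ p ∈ L, 𝓒 p := by
  simp only [← Submodule.map_iSup]
  refine le_antisymm (Submodule.map_le_iff_le_comap.2 (hf L hL)) fun x hx => ?_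
  exact ⟨_, hg L hL x hx, LinearMap.congr_fun hfg x⟩

theorem componentEnd_eq_zero_of_mem_biSup {ι : Type*} [DecidableEq ι] {𝓒 : ι → Submodule R C}
    [DirectSum.Decomposition 𝓒] {L : Set ι} {p : ι} (hp : p ∉ L) {x : C}
    (hx : x ∈ (⨆ q ∈ L, 𝓒 q : Submodule R C)) : componentEnd 𝓒 p x = 0 := by
  have h : (⨆ q ∈ L, 𝓒 q : Submodule R C) ≤ LinearMap.ker (componentEnd 𝓒 p) :=
    iSup₂_le fun q hq y hy => componentEnd_of_mem_ne 𝓒 hy (by rintro rfl; exact hp hq)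
  exact h hx

theorem filtered_sub_diagonalPart_mem {P : Type*} [PartialOrder P] [Fintype P] [DecidableEq P]
    {𝓒 : P → Submodule R C} [DirectSum.Decomposition 𝓒] {d : Module.End R C}
    (hfilt : ∀ p q : P, (∃ x ∈ 𝓒 q, (DirectSum.decompose 𝓒 (d x) p : C) ≠ 0) → p ≤ q)
    {p : P} {x : C} (hx : x ∈ 𝓒 p) :
    (d - diagonalPart 𝓒 d) x ∈ (⨆ q ∈ Set.Iio p, 𝓒 q : Submodule R C) := by
  rw [LinearMap.sub_apply, diagonalPart_of_mem 𝓒 d hx]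
  have h := Finset.sum_erase_eq_sub (f := fun q => componentEnd 𝓒 q (d x)) (Finset.mem_univ p)
  rw [sum_componentEnd 𝓒 (d x)] at h
  rw [← h]
  refine sum_mem fun q hq => ?_
  by_cases h : componentEnd 𝓒 q (d x) = 0
  · rw [h]
    exact zero_mem _
  · exact le_biSup 𝓒 (Set.mem_Iio.2 (lt_of_le_of_ne (hfilt q p ⟨x, hx, h⟩)
      (Finset.ne_of_mem_erase hq))) (componentEnd_mem 𝓒 q _)

end Filtered

/-- Lemma on splitting a poset filtered chain complex over a field: there exist families
`(W_p)`, `(V_p)`, `(B_p)`, `(H_p)` of ℤ-graded submodules such that: (i) `C = ⊕ W_p`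
with `(W_p)` filtered equivalent to `(C_p)`; (ii) `W_p = V_p ⊕ H_p ⊕ B_p`;
(iii) `d(V_p) ⊆ B_p` and `d|_{V_p} : V_p → B_p` is an isomorphism; (iv) the
`W_p`-component of `d h` vanishes for `h ∈ H_p` (i.e. `d h ∈ ⊕_{q ≠ p} W_q`);
(v) `H := ⊕ H_p` is `d`-invariant and `d(⊕_{p∈L} H_p) ⊆ ⊕_{p∈L} H_p` for every down
set `L`, so `(P,H,d|_H)` is again a poset filtered chain complex. -/
theorem stmt_12 {R : Type*} [Field R]
    {P : Type*} [PartialOrder P] [Fintype P] [DecidableEq P] [Nonempty P]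
    {C : Type*} [AddCommGroup C] [Module R C]
    (𝓩 : ℤ → Submodule R C) [DirectSum.Decomposition 𝓩]
    (𝓒 : P → Submodule R C) [DirectSum.Decomposition 𝓒]
    (hgr : ∀ p : P, ∀ x ∈ 𝓒 p, ∀ n : ℤ, (DirectSum.decompose 𝓩 x n : C) ∈ 𝓒 p)
    (d : C →ₗ[R] C)
    (hdeg : ∀ n : ℤ, ∀ x ∈ 𝓩 n, d x ∈ 𝓩 (n - 1))
    (hd2 : d ∘ₗ d = 0)
    (hfilt : ∀ p q : P, (∃ x ∈ 𝓒 q, (DirectSum.decompose 𝓒 (d x) p : C) ≠ 0) → p ≤ q) :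
    ∃ W V B H : P → Submodule R C,
      (∀ p : P, ∀ x ∈ W p, ∀ n : ℤ, (DirectSum.decompose 𝓩 x n : C) ∈ W p) ∧
      (∀ p : P, ∀ x ∈ V p, ∀ n : ℤ, (DirectSum.decompose 𝓩 x n : C) ∈ V p) ∧
      (∀ p : P, ∀ x ∈ B p, ∀ n : ℤ, (DirectSum.decompose 𝓩 x n : C) ∈ B p) ∧
      (∀ p : P, ∀ x ∈ H p, ∀ n : ℤ, (DirectSum.decompose 𝓩 x n : C) ∈ H p) ∧
      -- (i) C = ⊕_{p∈P} W_p, filtered equivalent to (C_p)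
      DirectSum.IsInternal W ∧
      (∀ L : Set P, IsLowerSet L →
        (⨆ p ∈ L, W p : Submodule R C) = (⨆ p ∈ L, 𝓒 p : Submodule R C)) ∧
      -- (ii) W_p = V_p ⊕ H_p ⊕ B_p
      (∀ p : P, V p ⊔ H p ⊔ B p = W p ∧ V p ⊓ (H p ⊔ B p) = ⊥ ∧ H p ⊓ B p = ⊥) ∧
      -- (iii) d(V_p) ⊆ B_p and d|_{V_p} : V_p → B_p is an isomorphism
      (∀ p : P, (∀ x ∈ V p, d x ∈ B p) ∧ (∀ x ∈ V p, d x = 0 → x = 0) ∧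
        (∀ y ∈ B p, ∃ x ∈ V p, d x = y)) ∧
      -- (iv) π_p (d h) = 0 for h ∈ H_p
      (∀ p : P, ∀ h ∈ H p, d h ∈ (⨆ q ∈ {q : P | q ≠ p}, W q : Submodule R C)) ∧
      -- (v) H := ⊕ H_p is d-invariant, compatibly with the filtration
      (∀ x ∈ (⨆ p : P, H p : Submodule R C), d x ∈ (⨆ p : P, H p : Submodule R C)) ∧
      (∀ L : Set P, IsLowerSet L →
        ∀ x ∈ (⨆ p ∈ L, H p : Submodule R C), d x ∈ (⨆ p ∈ L, H p : Submodule R C)) := by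
  have hdd (x : C) : d (d x) = 0 := LinearMap.congr_fun hd2 x
  obtain ⟨D, hD⟩ : ∃ D, D = diagonalPart 𝓒 d := ⟨_, rfl⟩
  obtain ⟨n, hn⟩ : ∃ n : Module.End R C, n = d - D := ⟨_, rfl⟩
  have hDmem (p : P) (x : C) (hx : x ∈ 𝓒 p) : D x ∈ 𝓒 p := hD ▸ diagonalPart_mem 𝓒 d hx
  have hnmem (p : P) (x : C) (hx : x ∈ 𝓒 p) :
      n x ∈ (⨆ q ∈ Set.Iio p, 𝓒 q : Submodule R C) := by
    rw [hn, hD]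
    exact filtered_sub_diagonalPart_mem hfilt hx
  have hDF : D ∈ filteredSubring 𝓒 := mem_filteredSubring_of_preserves hDmem
  have strict_mem {f : Module.End R C} (hf : ∀ p, ∀ x ∈ 𝓒 p,
      f x ∈ (⨆ q ∈ Set.Iio p, 𝓒 q : Submodule R C)) : f ∈ filteredSubring 𝓒 :=
    mem_filteredSubring fun p x hx =>
      (biSup_mono fun q (hq : q < p) => hq.le : _ ≤ ⨆ q ∈ Set.Iic p, 𝓒 q) (hf p x hx)
  have hnF : n ∈ filteredSubring 𝓒 := strict_mem hnmem
  have hdF : d ∈ filteredSubring 𝓒 := by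
    have h := add_mem hDF hnF
    rwa [hn, add_sub_cancel] at h
  have hDD : D * D = 0 := by
    refine linearMap_eq_of_eqOn_summands 𝓒 fun p x hx => ?_
    have h1 : componentEnd 𝓒 p (d (n x)) = 0 :=
      componentEnd_eq_zero_of_mem_biSup (L := Set.Iio p) (by simp)
        (hdF _ (isLowerSet_Iio p) _ (hnmem p x hx))
    have h2 : D (D x) = componentEnd 𝓒 p (d (D x)) := by
      conv_lhs => rw [hD, diagonalPart_of_mem 𝓒 d (hD ▸ hDmem p x hx)]
      rw [hD]
    have h3 : d (D x) = - d (n x) := by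
      rw [hn, LinearMap.sub_apply, map_sub, hdd]
      simp
    rw [Module.End.mul_apply, h2, h3, map_neg, h1]
    simp
  have hdZ : ShiftsDegree 𝓩 (-1) d := ShiftsDegree.of_mem hdeg
  have hDZ : ShiftsDegree 𝓩 (-1) D := hD ▸ hdZ.diagonalPart 𝓒 hgr
  have hnZ : ShiftsDegree 𝓩 (-1) n := hn ▸ hdZ.sub hDZ
  obtain ⟨t, htZ, htmem, hDtD, htDt, htt⟩ := exists_graded_homotopy 𝓒 𝓩 hgr hDZ hDmem hDD
  have htF : t ∈ filteredSubring 𝓒 := mem_filteredSubring_of_preserves htmem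
  have hint : DirectSum.IsInternal 𝓒 := DirectSum.Decomposition.isInternal 𝓒
  have htop : ⨆ p, 𝓒 p = ⊤ := hint.submodule_iSup_eq_top
  have hstrict_n {f : Module.End R C} (hf : ∀ p, ∀ x ∈ 𝓒 p, f x ∈ 𝓒 p) (p : P) (x : C)
      (hx : x ∈ 𝓒 p) : (n * f) x ∈ (⨆ q ∈ Set.Iio p, 𝓒 q : Submodule R C) :=
    hnmem p _ (hf p x hx)
  obtain ⟨M, ⟨hMF, hMZ⟩, hM, -⟩ := exists_inverse_one_add_of_isNilpotent
    (isNilpotent_of_strictly_filtered htop (hstrict_n htmem))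
    (filteredSubring 𝓒 ⊓ Subring.centralizer (Set.range (componentEnd 𝓩)))
    ⟨mul_mem hnF htF, ShiftsDegree.iff_mem_centralizer.1 (by simpa using hnZ.mul htZ)⟩
  replace hMZ := ShiftsDegree.iff_mem_centralizer.2 hMZ
  obtain ⟨s, hs⟩ : ∃ s, s = t * M := ⟨_, rfl⟩
  have hsF : s ∈ filteredSubring 𝓒 := hs ▸ mul_mem htF hMF
  have hsZ : ShiftsDegree 𝓩 1 s := by simpa [hs] using htZ.mul hMZ
  rw [hn] at hM
  obtain ⟨hst, hsdt, hsc⟩ := perturbed_homotopy htDt htt hM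
  rw [← hs] at hst hsdt hsc
  have hss : s * s = 0 := by
    conv_lhs => rhs; rw [hs]
    rw [← mul_assoc, hst, zero_mul]
  have hsds : s * d * s = s := by
    conv_lhs => rhs; rw [hs]
    rw [← mul_assoc, hsdt, hs]
  replace hd2 : d * d = 0 := hd2
  obtain ⟨a, ha⟩ : ∃ a, a = t * D := ⟨_, rfl⟩
  obtain ⟨b, hb⟩ : ∃ b, b = D * t := ⟨_, rfl⟩
  obtain ⟨c, hc⟩ : ∃ c, c = 1 - a - b := ⟨_, rfl⟩
  replace hsc : s * c = 0 := by rw [hc, ha, hb, hsc]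
  have hDc : D * c = 0 := by
    rw [hc, ha, hb, mul_sub, mul_sub, ← mul_assoc, ← mul_assoc, hDtD, hDD]
    simp
  have htc : t * c = 0 := by
    rw [hc, ha, hb, mul_sub, mul_sub, ← mul_assoc, ← mul_assoc, htDt, htt]
    simp
  have hct : c * t = 0 := by
    rw [hc, ha, hb, sub_mul, sub_mul, htDt, mul_assoc, htt]
    simp
  have haa : a * a = a := by rw [ha, ← mul_assoc, htDt]
  have hab : a * b = 0 := by rw [ha, hb, mul_assoc, ← mul_assoc D, hDD]; simp
  have hbb : b * b = b := by rw [hb, ← mul_assoc, hDtD]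
  have hac : a * c = 0 := by rw [ha, mul_assoc, hDc, mul_zero]
  have hbc : b * c = 0 := by rw [hb, mul_assoc, htc, mul_zero]
  have hcb : c * b = 0 := by rw [hc, sub_mul, sub_mul, hab, hbb]; simp
  have hcc : c * c = c := by
    conv_lhs => lhs; rw [hc]
    rw [sub_mul, sub_mul, hac, hbc]
    simp
  have hca : c * a = 0 := by rw [ha, ← mul_assoc, hct, zero_mul]
  have habc : a + c + b = 1 := by rw [hc]; abel
  have hamem (p : P) (x : C) (hx : x ∈ 𝓒 p) : a x ∈ 𝓒 p := ha ▸ htmem p _ (hDmem p x hx)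
  have hbmem (p : P) (x : C) (hx : x ∈ 𝓒 p) : b x ∈ 𝓒 p := hb ▸ hDmem p _ (htmem p x hx)
  have hcmem (p : P) (x : C) (hx : x ∈ 𝓒 p) : c x ∈ 𝓒 p :=
    hc ▸ sub_mem (sub_mem hx (hamem p x hx)) (hbmem p x hx)
  have haZ : ShiftsDegree 𝓩 0 a := ha ▸ htZ.mul hDZ
  have hbZ : ShiftsDegree 𝓩 0 b := hb ▸ hDZ.mul htZ
  have hcZ : ShiftsDegree 𝓩 0 c := hc ▸ (ShiftsDegree.one.sub haZ).sub hbZ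
  obtain ⟨e, he⟩ : ∃ e, e = 1 - s * d - d * s := ⟨_, rfl⟩
  have heF : e ∈ filteredSubring 𝓒 :=
    he ▸ sub_mem (sub_mem (one_mem _) (mul_mem hsF hdF)) (mul_mem hdF hsF)
  have het : e * t = 0 := by
    rw [he, sub_mul, sub_mul, hsdt, mul_assoc, hst]
    simp
  have hde : d * e = e * d := by
    rw [he]
    simp only [mul_sub, sub_mul, mul_one, one_mul, mul_assoc, hd2, mul_zero]
    rw [← mul_assoc d d, hd2]
    simp
  have hee : e * e = e := by
    have h1 : s * d * (s * d) = s * d := by rw [← mul_assoc, hsds]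
    have h2 : d * s * (d * s) = d * s := by rw [mul_assoc, ← mul_assoc s, hsds]
    have h3 : s * d * (d * s) = 0 := by rw [mul_assoc, ← mul_assoc d, hd2]; simp
    have h4 : d * s * (s * d) = 0 := by rw [mul_assoc, ← mul_assoc s, hss]; simp
    rw [he]
    simp only [mul_sub, sub_mul, mul_one, one_mul, h1, h2, h3, h4]
    abel
  have hedt : e * (d * t) = 0 := by rw [← mul_assoc, ← hde, mul_assoc, het, mul_zero]
  have hdc : d * c = n * c := by rw [hn, sub_mul, hDc, sub_zero]
  have hsnc : s * (n * c) = s * (d * c) := by rw [hdc]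
  obtain ⟨φ, hφ⟩ : ∃ φ, φ = a + d * t + e * c := ⟨_, rfl⟩
  have hφ' : φ = 1 + (n * t - s * (n * c)) := by
    have h : e * c = c - s * (d * c) := by
      rw [he, sub_mul, sub_mul, mul_assoc, mul_assoc, hsc]
      simp
    rw [hφ, hsnc, h, hn, hc, hb, sub_mul]
    abel
  have hφa : φ * a = a := by
    rw [hφ, add_mul, add_mul, haa, mul_assoc, mul_assoc, hca, ha, ← mul_assoc t, htt]
    simp
  have hφb : φ * b = d * t := by
    rw [hφ, add_mul, add_mul, hab, mul_assoc, mul_assoc, hcb, hb, ← mul_assoc t, htDt]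
    simp
  have hφc : φ * c = e * c := by
    rw [hφ, add_mul, add_mul, hac, mul_assoc, mul_assoc, htc, hcc]
    simp
  have hφZ : ShiftsDegree 𝓩 0 φ := by
    rw [hφ, he]
    exact (haZ.add (hdZ.mul htZ)).add
      (((ShiftsDegree.one.sub (hsZ.mul hdZ)).sub (hdZ.mul hsZ)).mul hcZ)
  have hNstrict (p : P) (x : C) (hx : x ∈ 𝓒 p) :
      (n * t - s * (n * c)) x ∈ (⨆ q ∈ Set.Iio p, 𝓒 q : Submodule R C) :=
    sub_mem (hstrict_n htmem p x hx) (hsF _ (isLowerSet_Iio p) _ (hstrict_n hcmem p x hx))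
  have hNF := strict_mem hNstrict
  obtain ⟨ψ, hψF, hψφ, hφψ⟩ := exists_inverse_one_add_of_isNilpotent
    (isNilpotent_of_strictly_filtered htop hNstrict) _ hNF
  rw [← hφ'] at hψφ hφψ
  have hφF : φ ∈ filteredSubring 𝓒 := hφ' ▸ add_mem (one_mem _) hNF
  have hφinj : Function.Injective φ :=
    Function.LeftInverse.injective (g := ψ) (LinearMap.congr_fun hψφ)
  have hφsurj : Function.Surjective φ :=
    Function.RightInverse.surjective (g := ψ) (LinearMap.congr_fun hφψ)
  have hWL {L : Set P} (hL : IsLowerSet L) : (⨆ p ∈ L, (𝓒 p).map φ) = ⨆ p ∈ L, 𝓒 p :=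
    map_biSup_eq_of_mem_filteredSubring hφF hψF hφψ hL
  have heφ : e * φ = e * c := by
    rw [hφ, mul_add, mul_add, hedt, ha, ← mul_assoc, het, ← mul_assoc, hee]
    simp
  have hHL {L : Set P} (hL : IsLowerSet L) :
      (⨆ p ∈ L, (𝓒 p).map (φ * c)) = (⨆ p ∈ L, 𝓒 p : Submodule R C).map e := by
    rw [hφc, ← heφ, ← hWL hL]
    simp only [Submodule.map_iSup, ← Submodule.map_comp]
    rfl
  have hH {L : Set P} (hL : IsLowerSet L) : ∀ x ∈ (⨆ p ∈ L, (𝓒 p).map (φ * c) : Submodule R C),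
      d x ∈ (⨆ p ∈ L, (𝓒 p).map (φ * c) : Submodule R C) := by
    rw [hHL hL]
    rintro _ ⟨x, hx, rfl⟩
    exact ⟨d x, hdF L hL x hx, (LinearMap.congr_fun hde x).symm⟩
  refine ⟨fun p => (𝓒 p).map φ, fun p => (𝓒 p).map (φ * a), fun p => (𝓒 p).map (φ * b),
    fun p => (𝓒 p).map (φ * c), fun p => hφZ.map_isGraded (hgr p),
    fun p => (hφZ.mul haZ).map_isGraded (hgr p), fun p => (hφZ.mul hbZ).map_isGraded (hgr p),
    fun p => (hφZ.mul hcZ).map_isGraded (hgr p), isInternal_map_of_bijective hint ⟨hφinj, hφsurj⟩,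
    fun L hL => hWL hL,
    fun p => map_idempotents_split hφinj habc haa hcc hab hac hcb (hamem p) (hbmem p) (hcmem p),
    fun p => ⟨?_, ?_, ?_⟩, ?_, ?_, fun L hL => hH hL⟩
  · rintro _ ⟨x, hx, rfl⟩
    refine ⟨D x, hDmem p x hx, ?_⟩
    rw [hφa, hφb, ha]
    rfl
  · rintro _ ⟨x, hx, rfl⟩ h
    rw [hφa, ha] at h ⊢
    have h' := LinearMap.congr_fun hsdt (D x)
    simp only [Module.End.mul_apply] at h h' ⊢
    rw [← h', h, map_zero]
  · rintro _ ⟨x, hx, rfl⟩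
    refine ⟨_, ⟨t x, htmem p x hx, rfl⟩, ?_⟩
    rw [hφa, hφb, ha]
    exact congrArg d (LinearMap.congr_fun htDt x)
  · rintro p _ ⟨x, hx, rfl⟩
    have h1 : d ((φ * c) x) = e (n (c x)) := by
      have h2 : d * (φ * c) = e * (n * c) := by
        rw [hφc, ← mul_assoc, hde, mul_assoc, hdc]
      exact LinearMap.congr_fun h2 x
    rw [h1]
    have h3 := heF _ (isLowerSet_Iio p) _ (hnmem p _ (hcmem p x hx))
    rw [← hWL (isLowerSet_Iio p)] at h3
    exact (biSup_mono fun q (hq : q < p) => hq.ne :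
      _ ≤ ⨆ q ∈ {q : P | q ≠ p}, (𝓒 q).map φ) h3
  · simpa using hH isLowerSet_univ
end
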